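/- Edge limit for class AII†: fix y ∈ ℝ and c ∈ ℂ, and set x_N := N + √N·y + c. Then lim_{N→∞} (1/√(2N)) · (N!/(2N)!) · ∑_{j=0}^{N} ((2j)!/j!) · (4 x_N)^{N−j} · e^{−2x_N} · E_{2j}(2 x_N) = (1/2) · e^{−y²/2} · ∫_{y/√2}^∞ e^{v²} · erfc(√2·v) dv. -/

import Mathlib

open Filter Finset MeasureTheory

/-- The truncated exponential `E_n(x) = ∑_{j=0}^n x^j/j!`. -/
noncomputable def truncExp (n : ℕ) (x : ℂ) : ℂ :=
  ∑ j ∈ Finset.range (n + 1), x ^ j / (Nat.factorial j : ℂ)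

/-- The complementary error function `erfc(t) = (2/√π) ∫_t^∞ e^{−s²} ds`. -/
noncomputable def erfc (t : ℝ) : ℝ :=
  (2 / Real.sqrt Real.pi) * ∫ s in Set.Ioi t, Real.exp (-s ^ 2)

/-- Integrating a finitely supported step function over the half-line gives a scaled sum. -/
lemma integral_natFloor_mul_eq_sum (f : ℕ → ℂ) {r : ℝ} (hr : 0 < r) (M : ℕ)
    (hf : ∀ n, M ≤ n → f n = 0) :
    ∫ s in Set.Ioi (0 : ℝ), f ⌊r * s⌋₊ = (∑ n ∈ range M, f n) / (r : ℂ) := by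
  rw [integral_comp_mul_left_Ioi (fun t => f ⌊t⌋₊) 0 hr, mul_zero, ← integral_Ici_eq_integral_Ioi]
  have h1 : ∀ t ∈ Set.Ici (0 : ℝ), f ⌊t⌋₊ =
      ∑ n ∈ range M, (Set.Ico (n : ℝ) (n + 1)).indicator (fun _ => f n) t := by
    intro t ht
    have hmem : ∀ n : ℕ, t ∈ Set.Ico (n : ℝ) (n + 1) ↔ n = ⌊t⌋₊ := by
      intro n
      rw [Set.mem_Ico, eq_comm, Nat.floor_eq_iff ht]
    by_cases hM : ⌊t⌋₊ < M
    · rw [Finset.sum_eq_single_of_mem ⌊t⌋₊ (Finset.mem_range.2 hM)]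
      · rw [Set.indicator_of_mem ((hmem _).2 rfl)]
      · intro n _ hn
        rw [Set.indicator_of_notMem (fun h => hn ((hmem n).1 h))]
    · rw [hf _ (not_lt.1 hM), Finset.sum_eq_zero]
      intro n hn
      rw [Set.indicator_of_notMem]
      intro h
      rw [← (hmem n).1 h] at hM
      exact hM (Finset.mem_range.1 hn)
  rw [setIntegral_congr_fun measurableSet_Ici h1, integral_finsetSum]
  · have h2 : ∀ n ∈ range M, ∫ t in Set.Ici (0 : ℝ),
        (Set.Ico (n : ℝ) (n + 1)).indicator (fun _ => f n) t = f n := by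
      intro n _
      rw [setIntegral_indicator measurableSet_Ico]
      have : Set.Ici (0 : ℝ) ∩ Set.Ico (n : ℝ) (n + 1) = Set.Ico (n : ℝ) (n + 1) := by
        apply Set.inter_eq_right.2
        intro t ht
        exact le_trans (Nat.cast_nonneg n) ht.1
      rw [this, setIntegral_const]
      simp [Measure.real]
    rw [Finset.sum_congr rfl h2, Complex.real_smul, Complex.ofReal_inv, div_eq_inv_mul]
  · intro n _
    apply Integrable.integrableOn
    rw [integrable_indicator_iff measurableSet_Ico]
    exact integrableOn_const (by simp)

/-- A triangular array of factors close to `1` has product converging to the exponential of the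
limit of the sums of the deviations. -/
lemma tendsto_prod_one_add_of_tendsto_sum {z : ℕ → ℕ → ℂ} {m : ℕ → ℕ} {ε : ℕ → ℝ} {t : ℂ}
    (hz : ∀ N, ∀ i < m N, ‖z N i‖ ≤ ε N) (hε : Tendsto ε atTop (nhds 0))
    (hmε : Tendsto (fun N => m N * ε N ^ 2) atTop (nhds 0))
    (hsum : Tendsto (fun N => ∑ i ∈ range (m N), z N i) atTop (nhds t)) :
    Tendsto (fun N => ∏ i ∈ range (m N), (1 + z N i)) atTop (nhds (Complex.exp t)) := by
  have hsmall : ∀ᶠ N in atTop, ε N < 1 / 2 := hε.eventually_lt_const (by norm_num)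
  have hlog : Tendsto (fun N => ∑ i ∈ range (m N), Complex.log (1 + z N i)) atTop (nhds t) := by
    have h0 : Tendsto (fun N => ∑ i ∈ range (m N), Complex.log (1 + z N i) -
        ∑ i ∈ range (m N), z N i) atTop (nhds 0) := by
      apply squeeze_zero_norm' _ hmε
      filter_upwards [hsmall] with N hN
      rw [← Finset.sum_sub_distrib]
      calc _ ≤ ∑ i ∈ range (m N), ε N ^ 2 := by
            apply norm_sum_le_of_le
            intro i hi
            have hi' := hz N i (Finset.mem_range.1 hi)
            have h1 := Complex.norm_log_one_add_sub_self_le (z := z N i) (by linarith)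
            have h2 : (1 - ‖z N i‖)⁻¹ ≤ 2 := by
              rw [inv_le_comm₀ (by linarith) (by norm_num)]
              linarith
            have h3 : ‖z N i‖ ^ 2 ≤ ε N ^ 2 := by gcongr
            nlinarith [sq_nonneg ‖z N i‖]
        _ = _ := by simp
    simpa using h0.add hsum
  refine ((Complex.continuous_exp.tendsto t).comp hlog).congr' ?_
  filter_upwards [hsmall] with N hN
  rw [Function.comp_apply, Complex.exp_sum]
  refine Finset.prod_congr rfl fun i hi => Complex.exp_log fun h => ?_
  have hi' := hz N i (Finset.mem_range.1 hi)
  rw [show z N i = -1 by linear_combination h, norm_neg, norm_one] at hi'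
  linarith

lemma sum_range_cast_eq (m : ℕ) : ∑ i ∈ range m, (i : ℂ) = m * (m - 1) / 2 := by
  induction m with
  | zero => simp
  | succ k ih => rw [Finset.sum_range_succ, ih]; push_cast; ring

lemma tendsto_prod_one_sub_div {m : ℕ → ℕ} {α x : ℕ → ℂ} {a : ℂ} {u β : ℝ}
    (hm : Tendsto (fun N : ℕ => (m N : ℝ) / √N) atTop (nhds u))
    (hα : Tendsto (fun N : ℕ => α N / (√N : ℝ)) atTop (nhds a))
    (hx : Tendsto (fun N : ℕ => x N / N) atTop (nhds 1)) :
    Tendsto (fun N => ∏ i ∈ range (m N), (1 - (α N + β * i) / x N)) atTop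
      (nhds (Complex.exp (-(a * u + β * u ^ 2 / 2)))) := by
  have hN0 : ∀ᶠ N : ℕ in atTop, 0 < √(N : ℝ) := by
    filter_upwards [eventually_gt_atTop 0] with N hN
    exact Real.sqrt_pos.2 (Nat.cast_pos.2 hN)
  have hsq : ∀ N : ℕ, √(N : ℝ) ^ 2 = N := fun N => Real.sq_sqrt (Nat.cast_nonneg N)
  have hinv : Tendsto (fun N : ℕ => (√(N : ℝ))⁻¹) atTop (nhds 0) :=
    tendsto_inv_atTop_zero.comp (Real.tendsto_sqrt_atTop.comp tendsto_natCast_atTop_atTop)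
  have hx' : Tendsto (fun N : ℕ => ‖x N / N‖⁻¹) atTop (nhds 1) := by
    simpa using hx.norm.inv₀ (by simp)
  have hq : Tendsto (fun N : ℕ => ‖α N / (√N : ℝ)‖ + |β| * ((m N : ℝ) / √N)) atTop
      (nhds (‖a‖ + |β| * u)) := hα.norm.add (hm.const_mul _)
  let ε : ℕ → ℝ := fun N => (‖α N‖ + |β| * m N) / ‖x N‖
  have hε_eq : ∀ᶠ N : ℕ in atTop, (‖α N / (√N : ℝ)‖ + |β| * ((m N : ℝ) / √N)) * ‖x N / N‖⁻¹ *
      (√(N : ℝ))⁻¹ = ε N := by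
    filter_upwards [hN0] with N hN
    simp only [ε, norm_div, Complex.norm_real, Complex.norm_natCast, Real.norm_of_nonneg hN.le]
    rw [inv_div]
    nth_rw 3 [← hsq N]
    by_cases hxN : ‖x N‖ = 0
    · simp [hxN]
    · field_simp
  have hq2 := hq.mul hx'
  have hε : Tendsto ε atTop (nhds 0) := by
    have := (hq2.mul hinv).congr' hε_eq
    simpa using this
  have hmε : Tendsto (fun N => m N * ε N ^ 2) atTop (nhds 0) := by
    have := (hm.mul ((hq2.pow 2))).mul hinv
    rw [mul_zero] at this
    refine this.congr' ?_
    filter_upwards [hε_eq, hN0] with N h hN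
    rw [← h]
    field_simp
  have hmC : Tendsto (fun N : ℕ => (m N : ℂ) / (√N : ℝ)) atTop (nhds (u : ℂ)) := by
    refine ((Complex.continuous_ofReal.tendsto u).comp hm).congr fun N => ?_
    simp
  have hinvC : Tendsto (fun N : ℕ => ((√(N : ℝ) : ℝ) : ℂ)⁻¹) atTop (nhds 0) := by
    refine ((Complex.continuous_ofReal.tendsto 0).comp hinv).congr fun N => ?_
    simp
  have hsum : Tendsto (fun N => ∑ i ∈ range (m N), -((α N + β * i) / x N)) atTop
      (nhds (-(a * u + β * u ^ 2 / 2))) := by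
    have h1 := (((hα.mul hmC).add (((hmC.mul (hmC.sub hinvC)).const_mul (β : ℂ)).div_const 2)).mul
      (hx.inv₀ one_ne_zero)).neg
    refine (h1.congr' ?_).trans_eq ?_
    · filter_upwards [hN0] with N hN
      have hs : ((√(N : ℝ) : ℝ) : ℂ) ≠ 0 := by exact_mod_cast hN.ne'
      have hs2 : (N : ℂ) = ((√(N : ℝ) : ℝ) : ℂ) ^ 2 := by
        rw [← Complex.ofReal_pow, hsq]; simp
      rw [Finset.sum_neg_distrib, ← Finset.sum_div, Finset.sum_add_distrib, ← Finset.mul_sum,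
        sum_range_cast_eq, Finset.sum_const, Finset.card_range, nsmul_eq_mul, inv_div, hs2]
      by_cases hxN : x N = 0
      · simp [hxN]
      · field_simp
    · congr 1
      rw [sub_zero, inv_one]
      ring
  have key := tendsto_prod_one_add_of_tendsto_sum (m := m) (ε := ε)
    (z := fun N i => -((α N + β * i) / x N)) ?_ hε hmε hsum
  · simpa only [← sub_eq_add_neg] using key
  · intro N i hi
    rw [norm_neg, norm_div]
    simp only [ε]
    gcongr
    refine (norm_add_le _ _).trans ?_
    rw [norm_mul, Complex.norm_real, Complex.norm_natCast, Real.norm_eq_abs]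
    gcongr

lemma natCast_descFactorial_le_pow_mul_exp {n : ℕ} (hn : 0 < n) (m : ℕ) :
    (n.descFactorial m : ℝ) ≤ n ^ m * Real.exp (-(m * (m - 1) / (2 * n))) := by
  have hn' : (0 : ℝ) < n := Nat.cast_pos.2 hn
  induction m with
  | zero => simp
  | succ k ih =>
    rw [Nat.descFactorial_succ, Nat.cast_mul]
    have h1 : ((n - k : ℕ) : ℝ) ≤ n * Real.exp (-(k / n)) := by
      have h2 := Real.add_one_le_exp (-((k : ℝ) / n))
      rcases le_total k n with h | h
      · rw [Nat.cast_sub h]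
        calc (n : ℝ) - k = n * (-(k / n) + 1) := by field_simp; ring
          _ ≤ _ := by gcongr
      · rw [Nat.sub_eq_zero_of_le h, Nat.cast_zero]
        positivity
    calc _ ≤ (n * Real.exp (-(k / n))) * (n ^ k * Real.exp (-(k * (k - 1) / (2 * n)))) := by
          gcongr
      _ = n ^ (k + 1) * (Real.exp (-(k / n)) * Real.exp (-(k * (k - 1) / (2 * n)))) := by ring
      _ = _ := by
          rw [← Real.exp_add]
          congr 2
          push_cast
          field_simp
          ring

/-- The scaled evaluation point `N + √N y + c`. -/
noncomputable def edgePoint (y : ℝ) (c : ℂ) (N : ℕ) : ℂ := (N : ℂ) + (√N : ℝ) * (y : ℂ) + c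

lemma tendsto_inv_sqrt_natCast : Tendsto (fun N : ℕ => ((√(N : ℝ) : ℝ) : ℂ)⁻¹) atTop (nhds 0) := by
  have hinv : Tendsto (fun N : ℕ => (√(N : ℝ))⁻¹) atTop (nhds 0) :=
    tendsto_inv_atTop_zero.comp (Real.tendsto_sqrt_atTop.comp tendsto_natCast_atTop_atTop)
  refine ((Complex.continuous_ofReal.tendsto 0).comp hinv).congr fun N => ?_
  simp

lemma ofReal_sqrt_natCast_sq (N : ℕ) : ((√(N : ℝ) : ℝ) : ℂ) ^ 2 = N := by
  rw [← Complex.ofReal_pow, Real.sq_sqrt (Nat.cast_nonneg N), Complex.ofReal_natCast]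

lemma ofReal_sqrt_natCast_ne_zero {N : ℕ} (hN : 0 < N) : ((√(N : ℝ) : ℝ) : ℂ) ≠ 0 :=
  Complex.ofReal_ne_zero.2 (Real.sqrt_pos.2 (Nat.cast_pos.2 hN)).ne'

lemma tendsto_edgeShift_div_sqrt (y : ℝ) (c : ℂ) :
    Tendsto (fun N : ℕ => ((√(N : ℝ) : ℝ) * (y : ℂ) + c) / (√(N : ℝ) : ℝ)) atTop (nhds (y : ℂ)) := by
  have h := (tendsto_inv_sqrt_natCast.const_mul c).const_add (y : ℂ)
  rw [mul_zero, add_zero] at h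
  refine h.congr' ?_
  filter_upwards [eventually_gt_atTop 0] with N hN
  have hs := ofReal_sqrt_natCast_ne_zero hN
  field_simp

lemma tendsto_edgeShift_div (y : ℝ) (c : ℂ) :
    Tendsto (fun N : ℕ => ((√(N : ℝ) : ℝ) * (y : ℂ) + c) / N) atTop (nhds 0) := by
  have h := (tendsto_edgeShift_div_sqrt y c).mul tendsto_inv_sqrt_natCast
  rw [mul_zero] at h
  refine h.congr' ?_
  filter_upwards [eventually_gt_atTop 0] with N hN
  have hs := ofReal_sqrt_natCast_ne_zero hN
  rw [← ofReal_sqrt_natCast_sq N]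
  field_simp

lemma edgePoint_div {y : ℝ} {c : ℂ} {N : ℕ} (hN : 0 < N) :
    edgePoint y c N / N = 1 + ((√(N : ℝ) : ℝ) * (y : ℂ) + c) / N := by
  have hs : (N : ℂ) ≠ 0 := Nat.cast_ne_zero.2 hN.ne'
  rw [edgePoint]
  field_simp
  ring

lemma tendsto_edgePoint_div (y : ℝ) (c : ℂ) :
    Tendsto (fun N : ℕ => edgePoint y c N / N) atTop (nhds 1) := by
  have h := (tendsto_edgeShift_div y c).const_add 1
  rw [add_zero] at h
  refine h.congr' ?_
  filter_upwards [eventually_gt_atTop 0] with N hN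
  rw [edgePoint_div hN]

lemma eventually_edgePoint_ne_zero (y : ℝ) (c : ℂ) : ∀ᶠ N in atTop, edgePoint y c N ≠ 0 := by
  filter_upwards [(tendsto_edgePoint_div y c).eventually_ne one_ne_zero] with N hN h
  simp [h] at hN

lemma tendsto_exp_mul_edgePoint_div_pow (y : ℝ) (c : ℂ) :
    Tendsto (fun N : ℕ => Complex.exp (2 * N - 2 * edgePoint y c N) *
      (edgePoint y c N / N) ^ (2 * N)) atTop (nhds (Complex.exp (-y ^ 2))) := by
  set z : ℕ → ℂ := fun N => ((√(N : ℝ) : ℝ) * (y : ℂ) + c) / N with hz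
  have hz0 : Tendsto z atTop (nhds 0) := tendsto_edgeShift_div y c
  have hNz : Tendsto (fun N : ℕ => N * z N ^ 2) atTop (nhds ((y : ℂ) ^ 2)) := by
    refine ((tendsto_edgeShift_div_sqrt y c).pow 2).congr' ?_
    filter_upwards [eventually_gt_atTop 0] with N hN
    have hs := ofReal_sqrt_natCast_ne_zero hN
    simp only [hz]
    rw [← ofReal_sqrt_natCast_sq N]
    field_simp
  have hsmall : ∀ᶠ N in atTop, ‖z N‖ < 1 / 2 := by
    have := hz0.norm
    rw [norm_zero] at this
    exact this.eventually_lt_const (by norm_num)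
  have hrem : Tendsto (fun N : ℕ => 2 * N * (Complex.log (1 + z N) - z N + z N ^ 2 / 2)) atTop
      (nhds 0) := by
    have hb : Tendsto (fun N : ℕ => 2 * (‖(N : ℂ) * z N ^ 2‖ * ‖z N‖)) atTop (nhds 0) := by
      simpa using (hNz.norm.mul hz0.norm).const_mul 2
    refine squeeze_zero_norm' ?_ hb
    filter_upwards [hsmall] with N hN
    have h1 := Complex.norm_log_sub_logTaylor_le 2 (z := z N) (by linarith)
    have h2 : Complex.logTaylor (2 + 1) (z N) = z N - z N ^ 2 / 2 := by
      simp [Complex.logTaylor_succ, Complex.logTaylor_zero]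
      ring
    have h3 : (1 - ‖z N‖)⁻¹ ≤ 2 := by
      rw [inv_le_comm₀ (by linarith) (by norm_num)]
      linarith
    rw [h2] at h1
    have h4 : ‖z N‖ ^ 3 * (1 - ‖z N‖)⁻¹ / 3 ≤ ‖z N‖ ^ 3 := by
      have : 0 ≤ ‖z N‖ ^ 3 := by positivity
      nlinarith
    have h5 : ‖Complex.log (1 + z N) - z N + z N ^ 2 / 2‖ ≤ ‖z N‖ ^ 3 := by
      refine le_trans (le_of_eq ?_) (h1.trans ?_)
      · congr 1; ring
      · norm_num at h4 ⊢; exact h4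
    rw [norm_mul, norm_mul, norm_mul, norm_pow, Complex.norm_natCast, Complex.norm_ofNat]
    calc _ ≤ 2 * (N : ℝ) * ‖z N‖ ^ 3 := by gcongr
      _ = _ := by ring
  have hlim : Tendsto (fun N : ℕ => 2 * N * (Complex.log (1 + z N) - z N)) atTop
      (nhds (-(y : ℂ) ^ 2)) := by
    have h := hrem.sub hNz
    rw [zero_sub] at h
    exact h.congr fun N => by ring
  refine ((Complex.continuous_exp.tendsto _).comp hlim).congr' ?_
  filter_upwards [hsmall, eventually_gt_atTop 0] with N hN hN0
  have hs : (N : ℂ) ≠ 0 := Nat.cast_ne_zero.2 hN0.ne'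
  have hne : 1 + z N ≠ 0 := fun h => by
    rw [show z N = -1 by linear_combination h, norm_neg, norm_one] at hN
    norm_num at hN
  rw [edgePoint_div hN0, Function.comp_apply, mul_sub, sub_eq_add_neg, Complex.exp_add, mul_comm]
  congr 1
  · congr 1
    simp only [hz, edgePoint]
    field_simp
    ring
  · rw [show (2 * N : ℂ) * Complex.log (1 + z N) = ((2 * N : ℕ) : ℂ) * Complex.log (1 + z N) by
      push_cast; ring, Complex.exp_nat_mul, Complex.exp_log hne]

lemma tendsto_sqrt_mul_poisson (y : ℝ) (c : ℂ) :
    Tendsto (fun N : ℕ => (√(2 * N) : ℝ) * (Complex.exp (-(2 * edgePoint y c N)) *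
      (2 * edgePoint y c N) ^ (2 * N) / (2 * N).factorial)) atTop
      (nhds (Complex.exp (-y ^ 2) / (√2 * √Real.pi : ℝ))) := by
  have h1 : Tendsto (fun N : ℕ => ((√2 * Stirling.stirlingSeq (2 * N) : ℝ) : ℂ)) atTop
      (nhds (√2 * √Real.pi : ℝ)) := by
    refine (Complex.continuous_ofReal.tendsto _).comp ?_
    exact (Stirling.tendsto_stirlingSeq_sqrt_pi.comp
      (tendsto_id.const_mul_atTop' two_pos)).const_mul _
  have hpi : ((√2 * √Real.pi : ℝ) : ℂ) ≠ 0 := by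
    rw [Complex.ofReal_ne_zero]
    have := Real.pi_pos
    positivity
  refine ((tendsto_exp_mul_edgePoint_div_pow y c).div h1 hpi).congr' ?_
  filter_upwards [eventually_gt_atTop 0] with N hN
  have hs : (N : ℂ) ≠ 0 := Nat.cast_ne_zero.2 hN.ne'
  have hf : ((2 * N).factorial : ℂ) ≠ 0 := Nat.cast_ne_zero.2 (Nat.factorial_ne_zero _)
  have hr : ((√(2 * N) : ℝ) : ℂ) ≠ 0 := by
    rw [Complex.ofReal_ne_zero]
    have : (0 : ℝ) < N := Nat.cast_pos.2 hN
    positivity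
  have h2 : ((√2 : ℝ) : ℂ) * ((√2 : ℝ) : ℂ) = 2 := by
    rw [← Complex.ofReal_mul, Real.mul_self_sqrt (by norm_num)]; simp
  have he : Complex.exp 1 ^ (2 * N) = Complex.exp (2 * N) := by
    rw [← Complex.exp_nat_mul]; push_cast; ring_nf
  have h2' : ((√2 : ℝ) : ℂ) ≠ 0 := left_ne_zero_of_mul (h2.trans_ne two_ne_zero)
  have hsq : ((√(2 * N) : ℝ) : ℂ) ^ 2 = 2 * N := by
    rw [← Complex.ofReal_pow, Real.sq_sqrt (by positivity)]; simp
  simp only [Pi.div_apply, Stirling.stirlingSeq]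
  push_cast
  rw [Real.sqrt_mul (by norm_num) (2 * N : ℝ), Complex.exp_sub, Complex.exp_neg]
  push_cast
  rw [div_pow, div_pow, he, mul_pow, mul_pow]
  field_simp

/-- The ratio of the summands of the double sum to its corner summand. -/
noncomputable def edgeTerm (y : ℝ) (c : ℂ) (N k m : ℕ) : ℂ :=
  (N.descFactorial k / edgePoint y c N ^ k) *
    ((2 * (N - k)).descFactorial m / (2 * edgePoint y c N) ^ m)

lemma natCast_descFactorial_div_pow {n m : ℕ} (h : m ≤ n) (w : ℂ) :
    (n.descFactorial m : ℂ) / w ^ m = ∏ i ∈ range m, (n - i) / w := by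
  rw [Nat.descFactorial_eq_prod_range, Finset.prod_div_distrib, Finset.prod_const,
    Finset.card_range, Nat.cast_prod]
  congr 1
  refine Finset.prod_congr rfl fun i hi => ?_
  rw [Nat.cast_sub ((Finset.mem_range.1 hi).le.trans h)]

lemma tendsto_floor_mul_sqrt_div {s : ℝ} (hs : 0 ≤ s) :
    Tendsto (fun N : ℕ => (⌊√(N : ℝ) * s⌋₊ : ℝ) / √N) atTop (nhds s) := by
  have := (tendsto_nat_floor_mul_div_atTop hs).comp
    (Real.tendsto_sqrt_atTop.comp tendsto_natCast_atTop_atTop)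
  refine this.congr fun N => ?_
  simp [mul_comm]

lemma tendsto_edgeTerm (y : ℝ) (c : ℂ) {s u : ℝ} {k m : ℕ → ℕ}
    (hk : Tendsto (fun N : ℕ => (k N : ℝ) / √N) atTop (nhds s))
    (hm : Tendsto (fun N : ℕ => (m N : ℝ) / √N) atTop (nhds u)) :
    Tendsto (fun N : ℕ => edgeTerm y c N (k N) (m N)) atTop
      (nhds ((Real.exp (-(y * s + s ^ 2 / 2)) *
        Real.exp (-((s + y) * u + u ^ 2 / 4)) : ℝ) : ℂ)) := by
  have hkC : Tendsto (fun N : ℕ => (k N : ℂ) / (√(N : ℝ) : ℝ)) atTop (nhds (s : ℂ)) := by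
    refine ((Complex.continuous_ofReal.tendsto _).comp hk).congr fun N => ?_
    simp
  have hα := tendsto_edgeShift_div_sqrt y c
  have hα' : Tendsto (fun N : ℕ => ((k N : ℂ) + ((√(N : ℝ) : ℝ) * (y : ℂ) + c)) / (√(N : ℝ) : ℝ))
      atTop (nhds ((s : ℂ) + y)) := (hkC.add hα).congr fun N => (add_div _ _ _).symm
  have hx := tendsto_edgePoint_div y c
  have h1 := tendsto_prod_one_sub_div (β := 1) hk hα hx
  have h2 := tendsto_prod_one_sub_div (β := 1 / 2) hm hα' hx
  have hle : ∀ᶠ N in atTop, k N + m N ≤ N := by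
    have h3 := (hk.add hm).eventually_lt_const (lt_add_one (s + u))
    have h4 : ∀ᶠ N : ℕ in atTop, s + u + 1 ≤ √(N : ℝ) :=
      (Real.tendsto_sqrt_atTop.comp tendsto_natCast_atTop_atTop).eventually_ge_atTop _
    filter_upwards [h3, h4, eventually_gt_atTop 0] with N h3 h4 hN
    have hpos : 0 < √(N : ℝ) := Real.sqrt_pos.2 (Nat.cast_pos.2 hN)
    rw [← add_div, div_lt_iff₀ hpos] at h3
    have h5 : (k N : ℝ) + m N ≤ N := by
      nlinarith [Real.sq_sqrt (Nat.cast_nonneg (α := ℝ) N)]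
    exact_mod_cast h5
  refine ((h1.mul h2).congr' ?_).trans_eq ?_
  · filter_upwards [hle, eventually_edgePoint_ne_zero y c] with N hN hx0
    rw [edgeTerm, natCast_descFactorial_div_pow (by omega), natCast_descFactorial_div_pow (by omega)]
    congr 1
    · refine Finset.prod_congr rfl fun i _ => ?_
      field_simp
      rw [edgePoint]
      push_cast
      ring
    · refine Finset.prod_congr rfl fun i _ => ?_
      rw [Nat.cast_mul, Nat.cast_sub (by omega)]
      field_simp
      rw [edgePoint]
      push_cast
      ring
  · congr 1
    push_cast
    congr 2 <;> ring

lemma eventually_div_norm_edgePoint_le (y : ℝ) (c : ℂ) :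
    ∃ A : ℝ, ∀ᶠ N : ℕ in atTop, N / ‖edgePoint y c N‖ ≤ Real.exp (A / √N) := by
  refine ⟨2 * (|y| + ‖c‖), ?_⟩
  have h4 : ∀ᶠ N : ℕ in atTop, 2 * (|y| + ‖c‖) ≤ √(N : ℝ) :=
    (Real.tendsto_sqrt_atTop.comp tendsto_natCast_atTop_atTop).eventually_ge_atTop _
  filter_upwards [h4, eventually_ge_atTop 1, eventually_edgePoint_ne_zero y c] with N hN hN1 hx0
  have hN1' : (1 : ℝ) ≤ √N := by
    rw [Real.one_le_sqrt]; exact_mod_cast hN1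
  have hpos : 0 < √(N : ℝ) := by linarith
  set t := (|y| + ‖c‖) / √(N : ℝ) with ht
  have ht0 : 0 ≤ t := by positivity
  have ht1 : t ≤ 1 / 2 := by
    rw [ht, div_le_iff₀ hpos]; linarith
  have hsq := Real.sq_sqrt (Nat.cast_nonneg (α := ℝ) N)
  have hx : N * (1 - t) ≤ ‖edgePoint y c N‖ := by
    have h1 : ‖(N : ℂ)‖ ≤ ‖edgePoint y c N‖ + ‖(√(N : ℝ) : ℝ) * (y : ℂ) + c‖ := by
      refine le_trans (le_of_eq ?_) (norm_sub_le _ _)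
      congr 1
      rw [edgePoint]; ring
    have h2 : ‖(√(N : ℝ) : ℝ) * (y : ℂ) + c‖ ≤ √(N : ℝ) * |y| + ‖c‖ := by
      refine (norm_add_le _ _).trans (le_of_eq ?_)
      rw [norm_mul, Complex.norm_real, Complex.norm_real, Real.norm_of_nonneg hpos.le,
        Real.norm_eq_abs]
    have h3 : N * t = √(N : ℝ) * (|y| + ‖c‖) := by
      rw [ht]
      nth_rw 1 [← hsq]
      field_simp
    rw [Complex.norm_natCast] at h1
    nlinarith [norm_nonneg c]
  have he : 1 + 2 * t ≤ Real.exp (2 * (|y| + ‖c‖) / √N) := by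
    have := Real.add_one_le_exp (2 * t)
    rw [ht, ← mul_div_assoc] at this ⊢
    linarith
  have hx0' : 0 < ‖edgePoint y c N‖ := norm_pos_iff.2 hx0
  rw [div_le_iff₀ hx0']
  calc (N : ℝ) ≤ (1 + 2 * t) * (N * (1 - t)) := by
        have : 0 ≤ (N : ℝ) * (t * (1 - 2 * t)) := by
          have : 0 ≤ 1 - 2 * t := by linarith
          positivity
        nlinarith
    _ ≤ Real.exp (2 * (|y| + ‖c‖) / √N) * ‖edgePoint y c N‖ :=
        mul_le_mul he hx (mul_nonneg (Nat.cast_nonneg N) (by linarith)) (Real.exp_nonneg _)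

lemma pow_mul_exp_le_of_floor {q A r β u : ℝ} (hq : 0 ≤ q) (hr : 1 ≤ r) (hu : 0 ≤ u) (hβ : 0 ≤ β)
    (hqA : q ≤ Real.exp (A / r)) :
    q ^ ⌊r * u⌋₊ * Real.exp (-(β * (⌊r * u⌋₊ * (⌊r * u⌋₊ - 1) / r ^ 2))) ≤
      Real.exp ((|A| + 3 * β) * u - β * u ^ 2) := by
  set m := ⌊r * u⌋₊
  have hr0 : 0 < r := by linarith
  have hm1 : (m : ℝ) ≤ r * u := Nat.floor_le (by positivity)
  have hm2 : r * u < m + 1 := Nat.lt_floor_add_one _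
  have hm0 : (0 : ℝ) ≤ m := Nat.cast_nonneg m
  have h1 : q ^ m ≤ Real.exp (|A| * u) := by
    calc q ^ m ≤ Real.exp (A / r) ^ m := by gcongr
      _ = Real.exp (m * (A / r)) := (Real.exp_nat_mul _ _).symm
      _ ≤ _ := by
        rw [Real.exp_le_exp]
        calc m * (A / r) ≤ m * (|A| / r) := by gcongr; exact le_abs_self A
          _ ≤ (r * u) * (|A| / r) := by gcongr
          _ = |A| * u := by field_simp
  have h2 : u ^ 2 - 3 * u ≤ m * (m - 1) / r ^ 2 := by
    rw [le_div_iff₀ (by positivity)]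
    have h3 : (r * u) ^ 2 - 2 * (r * u) ≤ (m : ℝ) ^ 2 := by
      rcases le_total 1 (r * u) with h | h
      · nlinarith
      · nlinarith [mul_nonneg hr0.le hu]
    have h4 : r * u ≤ r ^ 2 * u := by
      have : 0 ≤ r * u * (r - 1) := by
        have : 0 ≤ r - 1 := by linarith
        positivity
      nlinarith
    nlinarith
  calc _ ≤ Real.exp (|A| * u) * Real.exp (-(β * (u ^ 2 - 3 * u))) := by gcongr
    _ = _ := by rw [← Real.exp_add]; congr 1; ring

lemma norm_edgeTerm_le {y : ℝ} {c : ℂ} {N : ℕ} {A : ℝ} (hN : 1 ≤ N)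
    (hA : N / ‖edgePoint y c N‖ ≤ Real.exp (A / √N)) {s u : ℝ} (hs : 0 ≤ s) (hu : 0 ≤ u) :
    ‖edgeTerm y c N ⌊√(N : ℝ) * s⌋₊ ⌊√(N : ℝ) * u⌋₊‖ ≤
      Real.exp ((|A| + 3 * (1 / 2)) * s - 1 / 2 * s ^ 2) *
        Real.exp ((|A| + 3 * (1 / 4)) * u - 1 / 4 * u ^ 2) := by
  have hr : 1 ≤ √(N : ℝ) := by
    rw [Real.one_le_sqrt]; exact_mod_cast hN
  have hsq := Real.sq_sqrt (Nat.cast_nonneg (α := ℝ) N)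
  have hq : 0 ≤ N / ‖edgePoint y c N‖ := by positivity
  rw [edgeTerm, norm_mul]
  refine mul_le_mul (le_trans ?_ (pow_mul_exp_le_of_floor hq hr hs (by norm_num) hA))
    (le_trans ?_ (pow_mul_exp_le_of_floor hq hr hu (by norm_num) hA)) (norm_nonneg _)
    (Real.exp_nonneg _)
  · rw [hsq, norm_div, norm_pow, Complex.norm_natCast]
    have h := natCast_descFactorial_le_pow_mul_exp (by omega : 0 < N) ⌊√(N : ℝ) * s⌋₊
    calc _ ≤ _ := div_le_div_of_nonneg_right h (by positivity)
      _ = _ := by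
        rw [div_pow, mul_div_right_comm]
        congr 3
        ring
  · rw [hsq, norm_div, norm_pow, Complex.norm_natCast, norm_mul, Complex.norm_ofNat]
    have h := natCast_descFactorial_le_pow_mul_exp (by omega : 0 < 2 * N) ⌊√(N : ℝ) * u⌋₊
    have h' : ((2 * (N - ⌊√(N : ℝ) * s⌋₊)).descFactorial ⌊√(N : ℝ) * u⌋₊ : ℝ) ≤
        ((2 * N).descFactorial ⌊√(N : ℝ) * u⌋₊ : ℝ) := by
      exact_mod_cast Nat.descFactorial_le _ (by omega)
    calc _ ≤ _ := div_le_div_of_nonneg_right (h'.trans h) (by positivity)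
      _ = _ := by
        push_cast
        rw [mul_div_right_comm, ← div_pow, mul_div_mul_left _ _ two_ne_zero]
        congr 3
        ring

lemma integrable_exp_linear_sub_sq (a : ℝ) {b : ℝ} (hb : 0 < b) :
    Integrable fun u : ℝ => Real.exp (a * u - b * u ^ 2) := by
  have h := (integrable_cexp_quadratic (b := (b : ℂ)) (by simpa using hb) a 0).norm
  refine h.congr (Eventually.of_forall fun u => ?_)
  simp only [Complex.norm_exp]
  congr 1
  simp [← Complex.ofReal_pow]
  ring

lemma measurable_natFloor_mul_prod (f : ℕ → ℕ → ℂ) (r : ℝ) :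
    Measurable fun p : ℝ × ℝ => f ⌊r * p.1⌋₊ ⌊r * p.2⌋₊ := by
  have h1 : Measurable fun p : ℝ × ℝ => ⌊r * p.1⌋₊ := (measurable_fst.const_mul r).nat_floor
  have h2 : Measurable fun p : ℝ × ℝ => ⌊r * p.2⌋₊ := (measurable_snd.const_mul r).nat_floor
  have h3 : Measurable (Function.uncurry f) := Measurable.of_discrete
  exact h3.comp (h1.prodMk h2)

lemma tendsto_sum_edgeTerm_div (y : ℝ) (c : ℂ) :
    Tendsto (fun N : ℕ => (∑ k ∈ range (N + 1), ∑ m ∈ range (2 * (N - k) + 1),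
      edgeTerm y c N k m) / N) atTop
      (nhds ((∫ s in Set.Ioi (0 : ℝ), ∫ u in Set.Ioi (0 : ℝ), Real.exp (-(y * s + s ^ 2 / 2)) *
        Real.exp (-((s + y) * u + u ^ 2 / 4)) : ℝ) : ℂ)) := by
  set μ : Measure ℝ := volume.restrict (Set.Ioi 0) with hμ
  obtain ⟨A, hA⟩ := eventually_div_norm_edgePoint_le y c
  let F : ℕ → ℝ × ℝ → ℂ := fun N p => edgeTerm y c N ⌊√(N : ℝ) * p.1⌋₊ ⌊√(N : ℝ) * p.2⌋₊
  let f : ℝ × ℝ → ℝ := fun p => Real.exp (-(y * p.1 + p.1 ^ 2 / 2)) *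
    Real.exp (-((p.1 + y) * p.2 + p.2 ^ 2 / 4))
  let g : ℝ × ℝ → ℝ := fun p => Real.exp ((|A| + 3 * (1 / 2)) * p.1 - 1 / 2 * p.1 ^ 2) *
        Real.exp ((|A| + 3 * (1 / 4)) * p.2 - 1 / 4 * p.2 ^ 2)
  have hg1 : Integrable (fun s => Real.exp ((|A| + 3 * (1 / 2)) * s - 1 / 2 * s ^ 2)) μ :=
    (integrable_exp_linear_sub_sq (|A| + 3 * (1 / 2)) (b := 1 / 2) (by norm_num)).restrict
  have hg2 : Integrable (fun u => Real.exp ((|A| + 3 * (1 / 4)) * u - 1 / 4 * u ^ 2)) μ :=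
    (integrable_exp_linear_sub_sq (|A| + 3 * (1 / 4)) (b := 1 / 4) (by norm_num)).restrict
  have hg : Integrable g (μ.prod μ) := hg1.mul_prod hg2
  have hmem : ∀ᵐ p ∂(μ.prod μ), 0 ≤ p.1 ∧ 0 ≤ p.2 := by
    rw [hμ, Measure.prod_restrict]
    filter_upwards [ae_restrict_mem (measurableSet_Ioi.prod measurableSet_Ioi)] with p hp
    exact ⟨le_of_lt hp.1, le_of_lt hp.2⟩
  have hF_meas : ∀ N, AEStronglyMeasurable (F N) (μ.prod μ) := fun N =>
    (measurable_natFloor_mul_prod (edgeTerm y c N) √(N : ℝ)).aestronglyMeasurable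
  have hbound : ∀ᶠ N in atTop, ∀ᵐ p ∂(μ.prod μ), ‖F N p‖ ≤ g p := by
    filter_upwards [hA, eventually_ge_atTop 1] with N hN hN1
    filter_upwards [hmem] with p hp
    exact norm_edgeTerm_le hN1 hN hp.1 hp.2
  have hlim : ∀ᵐ p ∂(μ.prod μ), Tendsto (fun N => F N p) atTop (nhds (f p : ℂ)) := by
    filter_upwards [hmem] with p hp
    exact tendsto_edgeTerm y c (tendsto_floor_mul_sqrt_div hp.1) (tendsto_floor_mul_sqrt_div hp.2)
  have hconv := tendsto_integral_filter_of_dominated_convergence g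
    (Eventually.of_forall hF_meas) hbound hg hlim
  have hf : Integrable f (μ.prod μ) := by
    refine hg.mono' (by fun_prop) ?_
    filter_upwards [hlim, hmem] with p hp hp0
    have h1 := hp.norm
    rw [Complex.norm_real] at h1
    refine le_of_tendsto h1 ?_
    filter_upwards [hA, eventually_ge_atTop 1] with N hN hN1
    exact norm_edgeTerm_le hN1 hN hp0.1 hp0.2
  rw [integral_complex_ofReal, integral_prod _ hf] at hconv
  refine hconv.congr' ?_
  filter_upwards [hbound, eventually_ge_atTop 1] with N hN hN1
  have hr : 0 < √(N : ℝ) := Real.sqrt_pos.2 (by exact_mod_cast hN1)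
  rw [integral_prod _ (hg.mono' (hF_meas N) hN)]
  have hinner : ∀ s : ℝ, ∫ u, F N (s, u) ∂μ =
      (∑ m ∈ range (2 * (N - ⌊√(N : ℝ) * s⌋₊) + 1),
        edgeTerm y c N ⌊√(N : ℝ) * s⌋₊ m) / (√(N : ℝ) : ℝ) := by
    intro s
    refine integral_natFloor_mul_eq_sum (fun m => edgeTerm y c N ⌊√(N : ℝ) * s⌋₊ m) hr _ ?_
    intro m hm
    rw [edgeTerm, Nat.descFactorial_eq_zero_iff_lt.2 (by omega : 2 * (N - ⌊√(N : ℝ) * s⌋₊) < m)]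
    simp
  simp_rw [hinner]
  rw [hμ, integral_natFloor_mul_eq_sum (fun k => (∑ m ∈ range (2 * (N - k) + 1),
        edgeTerm y c N k m) / (√(N : ℝ) : ℝ)) hr (N + 1), ← Finset.sum_div, div_div, ← pow_two,
        ofReal_sqrt_natCast_sq]
  intro k hk
  simp [edgeTerm, Nat.descFactorial_eq_zero_iff_lt.2 (by omega : N < k)]

lemma factorial_ratio_mul_eq_edgeTerm {y : ℝ} {c : ℂ} {N k m : ℕ} (hx : edgePoint y c N ≠ 0)
    (hk : k ≤ N) (hm : m ≤ 2 * (N - k)) :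
    (N.factorial : ℂ) / (2 * N).factorial *
      (((2 * (N - k)).factorial : ℂ) / (N - k).factorial * (4 * edgePoint y c N) ^ k *
        Complex.exp (-(2 * edgePoint y c N)) *
        ((2 * edgePoint y c N) ^ (2 * (N - k) - m) / (2 * (N - k) - m).factorial)) =
    Complex.exp (-(2 * edgePoint y c N)) * (2 * edgePoint y c N) ^ (2 * N) / (2 * N).factorial *
      edgeTerm y c N k m := by
  rw [edgeTerm]
  set x := edgePoint y c N
  have h1 : ((N - k).factorial : ℂ) * N.descFactorial k = N.factorial := by
    exact_mod_cast Nat.factorial_mul_descFactorial hk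
  have h2 : ((2 * (N - k) - m).factorial : ℂ) * (2 * (N - k)).descFactorial m =
      (2 * (N - k)).factorial := by
    exact_mod_cast Nat.factorial_mul_descFactorial hm
  have hf : ∀ n : ℕ, (n.factorial : ℂ) ≠ 0 := fun n => Nat.cast_ne_zero.2 (Nat.factorial_ne_zero n)
  have h3 : (2 * x) ^ (2 * N) = (4 * x) ^ k * x ^ k * (2 * x) ^ m * (2 * x) ^ (2 * (N - k) - m) := by
    rw [show 2 * N = 2 * k + m + (2 * (N - k) - m) by omega, pow_add, pow_add, pow_mul, ← mul_pow]
    congr 3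
    ring
  rw [← h1, ← h2, h3]
  have hf1 := hf (N - k)
  have hf2 := hf (2 * (N - k) - m)
  have hf3 := hf (2 * N)
  have hx2 : 2 * x ≠ 0 := mul_ne_zero two_ne_zero hx
  generalize (2 * x) = w at *
  generalize 2 * (N - k) - m = l at *
  field_simp

lemma factorial_ratio_mul_sum_eq {y : ℝ} {c : ℂ} {N : ℕ} (hx : edgePoint y c N ≠ 0) :
    (N.factorial : ℂ) / (2 * N).factorial *
      ∑ j ∈ range (N + 1), (((2 * j).factorial : ℂ) / j.factorial) *
        (4 * edgePoint y c N) ^ (N - j) * Complex.exp (-(2 * edgePoint y c N)) *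
        truncExp (2 * j) (2 * edgePoint y c N) =
    Complex.exp (-(2 * edgePoint y c N)) * (2 * edgePoint y c N) ^ (2 * N) / (2 * N).factorial *
      ∑ k ∈ range (N + 1), ∑ m ∈ range (2 * (N - k) + 1), edgeTerm y c N k m := by
  rw [← Finset.sum_range_reflect, Finset.mul_sum, Finset.mul_sum]
  refine Finset.sum_congr rfl fun k hk => ?_
  have hk' : k ≤ N := Nat.lt_succ_iff.1 (Finset.mem_range.1 hk)
  rw [show N + 1 - 1 - k = N - k by omega, show N - (N - k) = k by omega, truncExp,
    ← Finset.sum_range_reflect, Finset.mul_sum, Finset.mul_sum, Finset.mul_sum]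
  refine Finset.sum_congr rfl fun m hm => ?_
  rw [show 2 * (N - k) + 1 - 1 - m = 2 * (N - k) - m by omega]
  exact factorial_ratio_mul_eq_edgeTerm hx hk' (Nat.lt_succ_iff.1 (Finset.mem_range.1 hm))

lemma setIntegral_Ioi_comp_add_right (g : ℝ → ℝ) (a w : ℝ) :
    ∫ x in Set.Ioi a, g (x + w) = ∫ x in Set.Ioi (a + w), g x := by
  have h := (measurePreserving_add_right volume w).setIntegral_preimage_emb
    (measurableEmbedding_addRight w) g (Set.Ioi (a + w))
  rwa [Set.preimage_add_const_Ioi, add_sub_cancel_right] at h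

lemma integral_Ioi_zero_exp_neg_quadratic (w : ℝ) :
    ∫ u in Set.Ioi (0 : ℝ), Real.exp (-(w * u + u ^ 2 / 4)) =
      Real.exp (w ^ 2) * √Real.pi * erfc w := by
  have h1 := integral_comp_mul_left_Ioi (fun t => Real.exp (-(t + w) ^ 2)) 0
    (by norm_num : (0 : ℝ) < 1 / 2)
  have h2 := setIntegral_Ioi_comp_add_right (fun t => Real.exp (-t ^ 2)) 0 w
  have h3 : ∀ u : ℝ, Real.exp (-(w * u + u ^ 2 / 4)) =
      Real.exp (w ^ 2) * Real.exp (-(1 / 2 * u + w) ^ 2) := fun u => by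
    rw [← Real.exp_add]; congr 1; ring
  simp_rw [h3]
  have hpi : √Real.pi ≠ 0 := (Real.sqrt_pos.2 Real.pi_pos).ne'
  rw [mul_zero, h2, zero_add, smul_eq_mul] at h1
  rw [integral_const_mul, h1, erfc]
  field_simp

lemma integral_exp_mul_exp_eq_erfc (y : ℝ) :
    ∫ s in Set.Ioi (0 : ℝ), ∫ u in Set.Ioi (0 : ℝ), Real.exp (-(y * s + s ^ 2 / 2)) *
        Real.exp (-((s + y) * u + u ^ 2 / 4)) =
      Real.exp (y ^ 2 / 2) * √Real.pi * √2 *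
        ∫ v in Set.Ioi (y / √2), Real.exp (v ^ 2) * erfc (√2 * v) := by
  have hs2 : (0 : ℝ) < √2 := by positivity
  have h1 : ∀ s : ℝ, ∫ u in Set.Ioi (0 : ℝ), Real.exp (-(y * s + s ^ 2 / 2)) *
        Real.exp (-((s + y) * u + u ^ 2 / 4)) = (Real.exp (y ^ 2 / 2) * √Real.pi) *
        (Real.exp ((s + y) ^ 2 / 2) * erfc (s + y)) := fun s => by
    rw [integral_const_mul, integral_Ioi_zero_exp_neg_quadratic]
    have : Real.exp (-(y * s + s ^ 2 / 2)) * Real.exp ((s + y) ^ 2) =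
        Real.exp (y ^ 2 / 2) * Real.exp ((s + y) ^ 2 / 2) := by
      rw [← Real.exp_add, ← Real.exp_add]; congr 1; ring
    linear_combination (√Real.pi * erfc (s + y)) * this
  simp_rw [h1]
  have h2 := setIntegral_Ioi_comp_add_right (fun w => Real.exp (w ^ 2 / 2) * erfc w) 0 y
  have h3 := integral_comp_mul_left_Ioi (fun w => Real.exp (w ^ 2 / 2) * erfc w) (y / √2) hs2
  have h4 : ∀ v : ℝ, (√2 * v) ^ 2 / 2 = v ^ 2 := fun v => by
    rw [mul_pow, Real.sq_sqrt (by norm_num)]; ring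
  simp_rw [h4] at h3
  rw [mul_div_cancel₀ _ hs2.ne', smul_eq_mul] at h3
  rw [integral_const_mul, h2, zero_add, h3]
  field_simp

/-- Edge limit for class AII† (complex self-dual): with `x_N = N + √N y + c`,
`(1/√(2N)) (N!/(2N)!) ∑_{j=0}^N ((2j)!/j!) (4x_N)^{N−j} e^{−2x_N} E_{2j}(2x_N)`
converges to `(1/2) e^{−y²/2} ∫_{y/√2}^∞ e^{v²} erfc(√2 v) dv`. -/
theorem statement10 (y : ℝ) (c : ℂ) :
    Tendsto (fun N : ℕ =>
        ((1 / Real.sqrt (2 * N) : ℝ) : ℂ) *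
          ((Nat.factorial N : ℂ) / (Nat.factorial (2 * N) : ℂ)) *
          ∑ j ∈ Finset.range (N + 1),
            ((Nat.factorial (2 * j) : ℂ) / (Nat.factorial j : ℂ)) *
              (4 * ((N : ℂ) + (Real.sqrt N : ℝ) * (y : ℂ) + c)) ^ (N - j) *
              Complex.exp (-(2 * ((N : ℂ) + (Real.sqrt N : ℝ) * (y : ℂ) + c))) *
              truncExp (2 * j) (2 * ((N : ℂ) + (Real.sqrt N : ℝ) * (y : ℂ) + c)))
      atTop
      (nhds (((1 / 2) * Real.exp (-y ^ 2 / 2) *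
        ∫ v in Set.Ioi (y / Real.sqrt 2), Real.exp (v ^ 2) * erfc (Real.sqrt 2 * v) : ℝ) : ℂ)) := by
  have h := ((tendsto_sqrt_mul_poisson y c).mul (tendsto_sum_edgeTerm_div y c)).div_const 2
  refine (h.congr' ?_).trans_eq ?_
  · filter_upwards [eventually_edgePoint_ne_zero y c, eventually_gt_atTop 0] with N hx hN
    have hNC : (N : ℂ) ≠ 0 := Nat.cast_ne_zero.2 hN.ne'
    have hsq : ((√(2 * N) : ℝ) : ℂ) ^ 2 = 2 * N := by
      rw [← Complex.ofReal_pow, Real.sq_sqrt (by positivity)]; simp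
    have hr : ((√(2 * N) : ℝ) : ℂ) ≠ 0 := fun h0 => by
      rw [h0] at hsq
      simp [hNC] at hsq
    have hr' : ((1 / √(2 * N) : ℝ) : ℂ) = (√(2 * N) : ℝ) / (2 * N) := by
      rw [← hsq]
      push_cast
      field_simp
    have hsum := factorial_ratio_mul_sum_eq hx
    simp only [edgePoint] at hsum ⊢
    rw [hr', mul_assoc (_ / (2 * (N : ℂ))), hsum]
    field_simp
  · have hreal : Real.exp (-y ^ 2) / (√2 * √Real.pi) *
        (∫ s in Set.Ioi (0 : ℝ), ∫ u in Set.Ioi (0 : ℝ), Real.exp (-(y * s + s ^ 2 / 2)) *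
          Real.exp (-((s + y) * u + u ^ 2 / 4))) / 2 =
        (1 / 2) * Real.exp (-y ^ 2 / 2) *
          ∫ v in Set.Ioi (y / √2), Real.exp (v ^ 2) * erfc (√2 * v) := by
      rw [integral_exp_mul_exp_eq_erfc,
        show -y ^ 2 / 2 = -y ^ 2 + y ^ 2 / 2 by ring, Real.exp_add]
      have hpi : √Real.pi ≠ 0 := (Real.sqrt_pos.2 Real.pi_pos).ne'
      field_simp
    rw [← hreal]
    push_cast
    rfl
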